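/- Let K be a field and let m, p be positive integers. Let S, T be m×p binary matrices with T ≤ S and let R be a p×p reflexive binary matrix with T·R^{p-1} ≤ S (Boolean product and power). Let Γ be an invertible p×p matrix over K, let Y be an m×p matrix over K, and let X be an invertible p×p matrix over K such that Y·Γ ∈ Sparse(T) and X·Γ ∈ Sparse(R). Then Y·X⁻¹ ∈ Sparse(S). (Core of Corollary 1: any feasible point of problem P_{T,R} yields a controller K = (Y_Q Γ)(X_Q Γ)⁻¹ = Y_Q X_Q⁻¹ with the desired sparsity S.) -/

import Mathlib

/-- Boolean (logical) matrix product. -/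
def bmul {m p q : ℕ} (A : Matrix (Fin m) (Fin p) Bool) (B : Matrix (Fin p) (Fin q) Bool) :
    Matrix (Fin m) (Fin q) Bool :=
  fun i k => decide (∃ j, A i j = true ∧ B j k = true)

/-- Identity binary matrix. -/
def bId (p : ℕ) : Matrix (Fin p) (Fin p) Bool := fun i j => decide (i = j)

/-- Boolean (entrywise OR) sum of binary matrices. -/
def badd {m p : ℕ} (A B : Matrix (Fin m) (Fin p) Bool) : Matrix (Fin m) (Fin p) Bool :=
  fun i j => A i j || B i j

/-- k-fold Boolean power (bpow R 0 = identity). -/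
def bpow {p : ℕ} (R : Matrix (Fin p) (Fin p) Bool) : ℕ → Matrix (Fin p) (Fin p) Bool
  | 0 => bId p
  | k + 1 => bmul (bpow R k) R

/-- Entrywise order on binary matrices. -/
def bLE {m p : ℕ} (A B : Matrix (Fin m) (Fin p) Bool) : Prop :=
  ∀ i j, A i j = true → B i j = true

/-- A square binary matrix is reflexive if all diagonal entries are 1. -/
def BRefl {p : ℕ} (R : Matrix (Fin p) (Fin p) Bool) : Prop := ∀ i, R i i = true

/-- Y ∈ Sparse(T): Y vanishes wherever the pattern T is zero. -/
def Sparse {K : Type*} [Field K] {m p : ℕ} (T : Matrix (Fin m) (Fin p) Bool)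
    (Y : Matrix (Fin m) (Fin p) K) : Prop :=
  ∀ i j, T i j = false → Y i j = 0

theorem bpow_le_bpow_succ {p : ℕ} {R : Matrix (Fin p) (Fin p) Bool} (hR : BRefl R) (k : ℕ) :
    bLE (bpow R k) (bpow R (k + 1)) := fun _ j h =>
  decide_eq_true ⟨j, h, hR j⟩

theorem bpow_mono {p : ℕ} {R : Matrix (Fin p) (Fin p) Bool} (hR : BRefl R) {k l : ℕ}
    (hkl : k ≤ l) : bLE (bpow R k) (bpow R l) := by
  induction l, hkl using Nat.le_induction with
  | base => exact fun _ _ h => h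
  | succ l _ ih => exact fun i j h => bpow_le_bpow_succ hR l i j (ih i j h)

theorem Sparse.mono {K : Type*} [Field K] {m p : ℕ} {S T : Matrix (Fin m) (Fin p) Bool}
    {Y : Matrix (Fin m) (Fin p) K} (hY : Sparse T Y) (h : bLE T S) : Sparse S Y := by
  intro i j hS
  refine hY i j (Bool.eq_false_iff.mpr fun hT => ?_)
  simp [h i j hT] at hS

theorem Sparse.mul {K : Type*} [Field K] {m p q : ℕ} {S : Matrix (Fin m) (Fin p) Bool}
    {T : Matrix (Fin p) (Fin q) Bool} {Y : Matrix (Fin m) (Fin p) K}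
    {Z : Matrix (Fin p) (Fin q) K} (hY : Sparse S Y) (hZ : Sparse T Z) :
    Sparse (bmul S T) (Y * Z) := by
  intro i k h
  rw [Matrix.mul_apply]
  refine Finset.sum_eq_zero fun j _ => ?_
  have hj := not_exists.mp (of_decide_eq_false h) j
  by_cases hS : S i j = true
  · rw [hZ j k (Bool.eq_false_iff.mpr fun hT => hj ⟨hS, hT⟩), mul_zero]
  · rw [hY i j (Bool.eq_false_iff.mpr hS), zero_mul]

theorem Sparse.pow {K : Type*} [Field K] {p : ℕ} {R : Matrix (Fin p) (Fin p) Bool}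
    {A : Matrix (Fin p) (Fin p) K} (hA : Sparse R A) (k : ℕ) : Sparse (bpow R k) (A ^ k) := by
  induction k with
  | zero => exact fun i j h => by rw [pow_zero, Matrix.one_apply_ne (of_decide_eq_false h)]
  | succ k ih => exact pow_succ A k ▸ ih.mul hA

/-- By the Cayley-Hamilton theorem, the inverse of a matrix is a polynomial in it. -/
theorem Matrix.inv_eq_smul_aeval_divX_charpoly {K n : Type*} [Field K] [Fintype n]
    [DecidableEq n] {A : Matrix n n K} (hA : IsUnit A.det) :
    A⁻¹ = (-(A.charpoly.coeff 0)⁻¹) • Polynomial.aeval A A.charpoly.divX := by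
  have hc : A.charpoly.coeff 0 ≠ 0 := by
    intro h
    have := A.det_eq_sign_charpoly_coeff
    rw [h, mul_zero] at this
    exact hA.ne_zero this
  have h := A.aeval_self_charpoly
  rw [← Polynomial.X_mul_divX_add A.charpoly] at h
  simp only [map_add, map_mul, Polynomial.aeval_X, Polynomial.aeval_C,
    Algebra.algebraMap_eq_smul_one] at h
  refine Matrix.inv_eq_right_inv ?_
  rw [Matrix.mul_smul, eq_neg_of_add_eq_zero_left h, smul_neg, smul_smul, neg_mul,
    inv_mul_cancel₀ hc, neg_smul, one_smul, neg_neg]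

theorem Sparse.inv {K : Type*} [Field K] {p : ℕ} {R : Matrix (Fin p) (Fin p) Bool}
    (hR : BRefl R) {A : Matrix (Fin p) (Fin p) K} (hA : Sparse R A) (hdet : IsUnit A.det) :
    Sparse (bpow R (p - 1)) A⁻¹ := by
  intro i j h
  rw [Matrix.inv_eq_smul_aeval_divX_charpoly hdet, Polynomial.aeval_eq_sum_range,
    Matrix.smul_apply, Matrix.sum_apply, Finset.sum_eq_zero, smul_zero]
  intro k hk
  have hkp : k ≤ p - 1 := by
    simpa [Polynomial.natDegree_divX_eq_natDegree_tsub_one, Nat.lt_succ_iff] using hk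
  rw [Matrix.smul_apply, (hA.pow k).mono (bpow_mono hR hkp) i j h, smul_zero]


/-- core of Corollary 1. -/
theorem SI_with_Gamma {K : Type*} [Field K] {m p : ℕ} (hm : 0 < m) (hp : 0 < p)
    (S T : Matrix (Fin m) (Fin p) Bool) (R : Matrix (Fin p) (Fin p) Bool)
    (hTS : bLE T S) (hR : BRefl R) (hTRS : bLE (bmul T (bpow R (p - 1))) S)
    (Γ : Matrix (Fin p) (Fin p) K) (hΓ : IsUnit Γ.det)
    (Y : Matrix (Fin m) (Fin p) K)
    (X : Matrix (Fin p) (Fin p) K) (hX : IsUnit X.det)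
    (hYΓ : Sparse T (Y * Γ)) (hXΓ : Sparse R (X * Γ)) :
    Sparse S (Y * X⁻¹) := by
  have hdet : IsUnit (X * Γ).det := by
    rw [Matrix.det_mul]
    exact hX.mul hΓ
  have hYX : Y * X⁻¹ = Y * Γ * (X * Γ)⁻¹ := by
    rw [Matrix.mul_inv_rev, Matrix.mul_assoc, Matrix.mul_nonsing_inv_cancel_left _ _ hΓ]
  rw [hYX]
  exact (hYΓ.mul (hXΓ.inv hR hdet)).mono hTRS
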